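/- arXiv:2010.08442 — 9 statements merged into one kernel-verified Lean document; each statement's English description precedes it below -/
import Mathlib

section
/- Let C11, C33, C13, C44, C66 be real numbers, set C12 = C11 − 2·C66, and let C be the 6×6 real symmetric matrix with rows [C11,C12,C13,0,0,0], [C12,C11,C13,0,0,0], [C13,C13,C33,0,0,0], [0,0,0,C44,0,0], [0,0,0,0,C44,0], [0,0,0,0,0,C66]. Then C is positive definite if and only if C11 − |C12| > 0, C33·(C11 + C12) > 2·C13², and C44 > 0. -/
/-- The sum-of-squares decomposition of the VTI quadratic form, scaled by `C11 + C12`. -/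
theorem vti_quadraticForm_eq_sum_sq (C11 C33 C13 C44 C66 C12 : ℝ)
    (hC12 : C12 = C11 - 2 * C66) (x : Fin 6 → ℝ) :
    (C11 + C12) * (star x ⬝ᵥ ((!![C11, C12, C13, 0, 0, 0;
                      C12, C11, C13, 0, 0, 0;
                      C13, C13, C33, 0, 0, 0;
                      0, 0, 0, C44, 0, 0;
                      0, 0, 0, 0, C44, 0;
                      0, 0, 0, 0, 0, C66] : Matrix (Fin 6) (Fin 6) ℝ).mulVec x)) =
      ((C11 + C12) * (x 0 + x 1) + 2 * C13 * x 2) ^ 2 / 2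
        + (C33 * (C11 + C12) - 2 * C13 ^ 2) * x 2 ^ 2
        + (C11 + C12) * (C11 - C12) / 2 * (x 0 - x 1) ^ 2
        + (C11 + C12) * C44 * x 3 ^ 2 + (C11 + C12) * C44 * x 4 ^ 2
        + (C11 + C12) * (C11 - C12) / 2 * x 5 ^ 2 := by
  obtain rfl : C66 = (C11 - C12) / 2 := by linarith
  simp [Matrix.mulVec, dotProduct, Fin.sum_univ_succ]
  ring

/-- A VTI stiffness matrix is positive definite iff the classical
VTI stability conditions hold. -/
theorem vti_posDef_iff (C11 C33 C13 C44 C66 C12 : ℝ)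
    (hC12 : C12 = C11 - 2 * C66) :
    Matrix.PosDef (!![C11, C12, C13, 0, 0, 0;
                      C12, C11, C13, 0, 0, 0;
                      C13, C13, C33, 0, 0, 0;
                      0, 0, 0, C44, 0, 0;
                      0, 0, 0, 0, C44, 0;
                      0, 0, 0, 0, 0, C66] : Matrix (Fin 6) (Fin 6) ℝ)
      ↔ (C11 - |C12| > 0 ∧ C33 * (C11 + C12) > 2 * C13 ^ 2 ∧ C44 > 0) := by
  have key := vti_quadraticForm_eq_sum_sq C11 C33 C13 C44 C66 C12 hC12
  constructor
  · intro h
    have hsum : 0 < C11 + C12 := by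
      have := h.dotProduct_mulVec_pos (x := ![1, 1, 0, 0, 0, 0])
        (fun h0 => by simpa using congrFun h0 0)
      simp [Matrix.mulVec, dotProduct, Fin.sum_univ_succ] at this
      linarith
    have hdiff : 0 < C11 - C12 := by
      have := h.dotProduct_mulVec_pos (x := ![1, -1, 0, 0, 0, 0])
        (fun h0 => by simpa using congrFun h0 0)
      simp [Matrix.mulVec, dotProduct, Fin.sum_univ_succ] at this
      linarith
    refine ⟨sub_pos.2 (abs_lt.2 ⟨by linarith, by linarith⟩), ?_, ?_⟩
    · have hpos := mul_pos hsum (h.dotProduct_mulVec_pos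
        (x := ![-C13, -C13, C11 + C12, 0, 0, 0])
        (fun h0 => hsum.ne' (by simpa using congrFun h0 2)))
      rw [key] at hpos
      simp at hpos
      have hmul : 0 < (C33 * (C11 + C12) - 2 * C13 ^ 2) * (C11 + C12) ^ 2 := by
        linear_combination hpos
      exact sub_pos.1 (pos_of_mul_pos_left hmul (sq_nonneg _))
    · have := h.diag_pos (i := 3)
      simpa using this
  · rintro ⟨habs, hdet, h44⟩
    obtain ⟨hlo, hhi⟩ := abs_lt.1 (sub_pos.1 habs)
    have hsum : 0 < C11 + C12 := by linarith
    have hdiff : 0 < C11 - C12 := by linarith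
    have hdet : 0 < C33 * (C11 + C12) - 2 * C13 ^ 2 := sub_pos.2 hdet
    have hprod : 0 < (C11 + C12) * (C11 - C12) / 2 := by positivity
    have hshear : 0 < (C11 + C12) * C44 := by positivity
    refine .of_dotProduct_mulVec_pos ?_ fun x hx => ?_
    · ext i j
      fin_cases i <;> fin_cases j <;> simp
    · refine pos_of_mul_pos_right ?_ hsum.le
      rw [key]
      by_contra! hle
      have n0 := sq_nonneg ((C11 + C12) * (x 0 + x 1) + 2 * C13 * x 2)
      have n2 := mul_nonneg hdet.le (sq_nonneg (x 2))
      have n1 := mul_nonneg hprod.le (sq_nonneg (x 0 - x 1))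
      have n3 := mul_nonneg hshear.le (sq_nonneg (x 3))
      have n4 := mul_nonneg hshear.le (sq_nonneg (x 4))
      have n5 := mul_nonneg hprod.le (sq_nonneg (x 5))
      have eq_zero {a b : ℝ} (ha : 0 < a) (hb : a * b ^ 2 ≤ 0) : b = 0 :=
        pow_eq_zero_iff two_ne_zero |>.1
          (le_antisymm (nonpos_of_mul_nonpos_right hb ha) (sq_nonneg b))
      have x2 : x 2 = 0 := eq_zero hdet (by linarith)
      have x01 : x 0 - x 1 = 0 := eq_zero hprod (by linarith)
      have x3 : x 3 = 0 := eq_zero hshear (by linarith)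
      have x4 : x 4 = 0 := eq_zero hshear (by linarith)
      have x5 : x 5 = 0 := eq_zero hprod (by linarith)
      have hlin : (C11 + C12) * (x 0 + x 1) + 2 * C13 * x 2 = 0 :=
        eq_zero one_pos (by linarith)
      have hadd : x 0 + x 1 = 0 := by simpa [x2, hsum.ne'] using hlin
      have x0 : x 0 = 0 := by linarith
      have x1 : x 1 = 0 := by linarith
      apply hx
      ext i
      fin_cases i <;> assumption
end

section
/- Suppose both halfspaces are orthotropic (C16 = C26 = C36 = C45 = 0 for both), and suppose the upper halfspace is VTI: C44^u = C55^u, C13^u = C23^u, C11^u = C22^u, and C12^u = C11^u − 2·C66^u. Then for every θ with cos θ ≠ 0 and every azimuth ψ, R_pp(θ, 0) − R_pp(θ, ψ) = (1/(2·C33^ℓ))·sin²θ·sin²ψ·{ 2·C44^ℓ − 2·C55^ℓ + C13^ℓ − C23^ℓ + (1/2)·tan²θ·[ 2·C11^ℓ − 2·C12^ℓ − 4·C66^ℓ + sin²ψ·(2·C12^ℓ + 4·C66^ℓ − C11^ℓ − C22^ℓ) ] }. -/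
open Real

/-- Voigt stiffness parameters of a halfspace. -/
structure Voigt where
  c11 : ℝ
  c12 : ℝ
  c13 : ℝ
  c16 : ℝ
  c22 : ℝ
  c23 : ℝ
  c26 : ℝ
  c33 : ℝ
  c36 : ℝ
  c44 : ℝ
  c45 : ℝ
  c55 : ℝ
  c66 : ℝ

/-- Contrast of a stiffness expression between the lower and upper halfspaces. -/
def Voigt.Δ (u l : Voigt) (f : Voigt → ℝ) : ℝ := f l - f u

/-- The Vavryčuk–Pšenčík approximation of the PP-wave reflection coefficient,
with isotropic part `Ripp`, upper halfspace `u`, lower halfspace `l`,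
incidence angle `θ`, and azimuth `ψ`. -/
noncomputable def Rpp (Ripp : ℝ → ℝ) (u l : Voigt) (θ ψ : ℝ) : ℝ :=
  Ripp θ
  + (1 / 2) * sin θ ^ 2 *
      ( (u.Δ l (fun C => (C.c23 + 2 * C.c44 - C.c33) / C.c33)
          - 8 * u.Δ l (fun C => (C.c44 - C.c55) / (2 * C.c33))) * sin ψ ^ 2
        + u.Δ l (fun C => (C.c13 + 2 * C.c55 - C.c33) / C.c33) * cos ψ ^ 2
        + 2 * (u.Δ l (fun C => (C.c36 + 2 * C.c45) / C.c33)
            - 4 * u.Δ l (fun C => C.c45 / C.c33)) * sin ψ * cos ψ )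
  + (1 / 2) * sin θ ^ 2 * tan θ ^ 2 *
      ( u.Δ l (fun C => (C.c22 - C.c33) / (2 * C.c33)) * sin ψ ^ 4
        + u.Δ l (fun C => (C.c11 - C.c33) / (2 * C.c33)) * cos ψ ^ 4
        + u.Δ l (fun C => (C.c12 + 2 * C.c66 - C.c33) / C.c33) * sin ψ ^ 2 * cos ψ ^ 2
        + u.Δ l (fun C => C.c26 / C.c33) * sin ψ ^ 3 * cos ψ
        + u.Δ l (fun C => C.c16 / C.c33) * cos ψ ^ 3 * sin ψ )

/-- For orthotropic halfspaces with a VTI upper halfspace, the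
difference of the reflection coefficient between azimuth 0 and azimuth ψ is
controlled by the lower-halfspace stiffnesses only. -/
theorem rpp_azimuthal_difference_psi (Ripp : ℝ → ℝ) (u l : Voigt)
    (hu33 : u.c33 ≠ 0) (hl33 : l.c33 ≠ 0)
    (hu16 : u.c16 = 0) (hu26 : u.c26 = 0) (hu36 : u.c36 = 0) (hu45 : u.c45 = 0)
    (hl16 : l.c16 = 0) (hl26 : l.c26 = 0) (hl36 : l.c36 = 0) (hl45 : l.c45 = 0)
    (hu4455 : u.c44 = u.c55) (hu1323 : u.c13 = u.c23) (hu1122 : u.c11 = u.c22)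
    (hu12 : u.c12 = u.c11 - 2 * u.c66) :
    ∀ θ : ℝ, cos θ ≠ 0 → ∀ ψ : ℝ,
      Rpp Ripp u l θ 0 - Rpp Ripp u l θ ψ
        = (1 / (2 * l.c33)) * sin θ ^ 2 * sin ψ ^ 2 *
            (2 * l.c44 - 2 * l.c55 + l.c13 - l.c23
              + (1 / 2) * tan θ ^ 2 *
                (2 * l.c11 - 2 * l.c12 - 4 * l.c66
                  + sin ψ ^ 2 * (2 * l.c12 + 4 * l.c66 - l.c11 - l.c22))) := by
  intro θ _ ψ
  have hcos4 : cos ψ ^ 4 = (1 - sin ψ ^ 2) ^ 2 := by rw [← cos_sq']; ring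
  simp only [Rpp, Voigt.Δ, sin_zero, cos_zero, hu16, hu26, hu36, hu45, hl16, hl26, hl36, hl45,
    hu4455, hu1323, hu1122, hu12, hcos4, cos_sq']
  generalize tan θ = t
  field_simp
  ring
end

section
/- Let c11, c33, c13, c44, c66 satisfy the VTI stability conditions and let e ≥ 0. Then c13² < c1² = c11·c33 (so c1 − c13 > 0 and c1 + c13 > 0), c3 > 0, c2 + c3 − c4 > 0, and consequently the crack compliances satisfy Z_N ≥ 0 and Z_T ≥ 0, with Z_N > 0 and Z_T > 0 whenever e > 0. -/
/-- `c₁ = √(c11·c33)`. -/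
noncomputable def cc1 (c11 c33 : ℝ) : ℝ := Real.sqrt (c11 * c33)

/-- `c₂ = √(c66/c44)`. -/
noncomputable def cc2 (c44 c66 : ℝ) : ℝ := Real.sqrt (c66 / c44)

/-- `c₃ = √((c₁ − c13)(c₁ + c13 + 2·c44)/(c33·c44))`. -/
noncomputable def cc3 (c11 c33 c13 c44 : ℝ) : ℝ :=
  Real.sqrt ((cc1 c11 c33 - c13) * (cc1 c11 c33 + c13 + 2 * c44) / (c33 * c44))

/-- `c₄ = 2·c44·c₃/(c₁ + c13 + 2·c44)`. -/
noncomputable def cc4 (c11 c33 c13 c44 : ℝ) : ℝ :=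
  2 * c44 * cc3 c11 c33 c13 c44 / (cc1 c11 c33 + c13 + 2 * c44)

/-- Normal crack compliance `Z_N = 8·c₃·e/(3·c₁·(1 − c13²/c₁²))` of a dry
circular crack in a VTI background. -/
noncomputable def ZN (c11 c33 c13 c44 e : ℝ) : ℝ :=
  8 * cc3 c11 c33 c13 c44 * e /
    (3 * cc1 c11 c33 * (1 - c13 ^ 2 / (cc1 c11 c33) ^ 2))

/-- Tangential crack compliance `Z_T = 16·e/(3·c44·(c₂ + c₃ − c₄))` of a dry
circular crack in a VTI background. -/
noncomputable def ZT (c11 c33 c13 c44 c66 e : ℝ) : ℝ :=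
  16 * e / (3 * c44 * (cc2 c44 c66 + cc3 c11 c33 c13 c44 - cc4 c11 c33 c13 c44))

/-- Under the VTI stability conditions, `c13² < c1² = c11·c33`,
`c3 > 0`, `c2 + c3 − c4 > 0`, and consequently `Z_N ≥ 0`, `Z_T ≥ 0`, with
strict positivity whenever `e > 0`. -/
theorem crack_compliances_nonneg (c11 c33 c13 c44 c66 e : ℝ)
    (h1 : c11 - |c11 - 2 * c66| > 0)
    (h2 : c33 * (c11 + (c11 - 2 * c66)) > 2 * c13 ^ 2)
    (h3 : c44 > 0) (he : 0 ≤ e) :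
    c13 ^ 2 < c11 * c33 ∧ (cc1 c11 c33) ^ 2 = c11 * c33 ∧
    cc1 c11 c33 - c13 > 0 ∧ cc1 c11 c33 + c13 > 0 ∧
    cc3 c11 c33 c13 c44 > 0 ∧
    cc2 c44 c66 + cc3 c11 c33 c13 c44 - cc4 c11 c33 c13 c44 > 0 ∧
    ZN c11 c33 c13 c44 e ≥ 0 ∧ ZT c11 c33 c13 c44 c66 e ≥ 0 ∧
    (0 < e → ZN c11 c33 c13 c44 e > 0 ∧ ZT c11 c33 c13 c44 c66 e > 0) := by
  obtain ⟨hl, hr⟩ := abs_lt.mp (sub_pos.mp h1)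
  have h66 : 0 < c66 := by linarith
  have h11 : 0 < c11 := by linarith
  have h33 : 0 < c33 := by
    by_contra! h
    nlinarith [sq_nonneg c13, mul_nonneg (neg_nonneg.mpr h) (by linarith : 0 ≤ c11 - c66)]
  have hlt : c13 ^ 2 < c11 * c33 := by nlinarith [mul_pos h33 h66]
  have hsq : (cc1 c11 c33) ^ 2 = c11 * c33 := Real.sq_sqrt (mul_pos h11 h33).le
  have hc1 : 0 < cc1 c11 c33 := Real.sqrt_pos.mpr (mul_pos h11 h33)
  obtain ⟨hneg, hpos⟩ := abs_lt.mp (abs_lt_of_sq_lt_sq (hsq ▸ hlt) hc1.le)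
  have hsub : 0 < cc1 c11 c33 - c13 := by linarith
  have hadd : 0 < cc1 c11 c33 + c13 := by linarith
  have hden : 0 < cc1 c11 c33 + c13 + 2 * c44 := by linarith
  have hc3 : 0 < cc3 c11 c33 c13 c44 :=
    Real.sqrt_pos.mpr (div_pos (mul_pos hsub hden) (mul_pos h33 h3))
  have hc2 : 0 ≤ cc2 c44 c66 := Real.sqrt_nonneg _
  have hc4 : cc4 c11 c33 c13 c44 < cc3 c11 c33 c13 c44 := by
    rw [cc4, div_lt_iff₀ hden]
    nlinarith [mul_pos hc3 hadd]
  have hsum : 0 < cc2 c44 c66 + cc3 c11 c33 c13 c44 - cc4 c11 c33 c13 c44 := by linarith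
  have hratio : 0 < 1 - c13 ^ 2 / (cc1 c11 c33) ^ 2 := by
    rw [sub_pos, div_lt_one (by positivity), hsq]
    exact hlt
  refine ⟨hlt, hsq, hsub, hadd, hc3, hsum, ?_, ?_, fun hepos => ⟨?_, ?_⟩⟩
  · unfold ZN; positivity
  · unfold ZT; positivity
  · unfold ZN; positivity
  · unfold ZT; positivity
end

section
/- Let c11, c33, c13, c44, c66 satisfy the VTI stability conditions, let Z_N ≥ 0 and Z_T ≥ 0, and let S₀ be the inverse of the VTI stiffness matrix with parameters c11, c33, c13, c44, c66. Let ΔS be the 6×6 matrix whose only nonzero entries are (ΔS)₁₁ = Z_N, (ΔS)₅₅ = Z_T, (ΔS)₆₆ = Z_T. Then S₀ + ΔS is invertible and (S₀ + ΔS)⁻¹ equals the 6×6 symmetric matrix with rows [c11·(1−δ_N), c12·(1−δ_N), c13·(1−δ_N), 0,0,0], [c12·(1−δ_N), c11·(1−δ_N·c12²/c11²), c13·(1−δ_N·c12/c11), 0,0,0], [c13·(1−δ_N), c13·(1−δ_N·c12/c11), c33·(1−δ_N·c13²/(c11·c33)), 0,0,0], [0,0,0,c44,0,0], [0,0,0,0,c44·(1−δ_T1),0],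 [0,0,0,0,0,c66·(1−δ_T2)], where c12 = c11 − 2·c66, δ_N = Z_N·c11/(1 + Z_N·c11), δ_T1 = Z_T·c44/(1 + Z_T·c44), δ_T2 = Z_T·c66/(1 + Z_T·c66). -/
/-- The VTI stiffness matrix with parameters `c11, c33, c13, c44, c66`
(and `c12 = c11 − 2·c66`). -/
def vtiMatrix (c11 c33 c13 c44 c66 : ℝ) : Matrix (Fin 6) (Fin 6) ℝ :=
  !![c11, c11 - 2 * c66, c13, 0, 0, 0;
     c11 - 2 * c66, c11, c13, 0, 0, 0;
     c13, c13, c33, 0, 0, 0;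
     0, 0, 0, c44, 0, 0;
     0, 0, 0, 0, c44, 0;
     0, 0, 0, 0, 0, c66]

theorem isUnit_vtiMatrix {c11 c33 c13 c44 c66 : ℝ} (h44 : c44 ≠ 0) (h66 : c66 ≠ 0)
    (hD : c33 * (c11 + (c11 - 2 * c66)) - 2 * c13 ^ 2 ≠ 0) :
    IsUnit (vtiMatrix c11 c33 c13 c44 c66) := by
  set D := c33 * (c11 + (c11 - 2 * c66)) - 2 * c13 ^ 2 with hD_def
  let a := (c11 * c33 - c13 ^ 2) / (2 * c66 * D)
  let b := -((c11 - 2 * c66) * c33 - c13 ^ 2) / (2 * c66 * D)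
  let e := -c13 / D
  let f := (c11 + (c11 - 2 * c66)) / D
  refine IsUnit.of_mul_eq_one_right
    !![a, b, e, 0, 0, 0;
       b, a, e, 0, 0, 0;
       e, e, f, 0, 0, 0;
       0, 0, 0, c44⁻¹, 0, 0;
       0, 0, 0, 0, c44⁻¹, 0;
       0, 0, 0, 0, 0, c66⁻¹] ?_
  ext i j
  fin_cases i <;> fin_cases j <;>
    simp [vtiMatrix, Matrix.mul_apply, Fin.sum_univ_succ, a, b, e, f, h44, h66] <;>
    field_simp <;> rw [hD_def] <;> ring

/-- If `M` solves `M + M * E * C = C`, then `M` is the inverse of the compliance `C⁻¹ + E`. -/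
theorem Matrix.mul_inv_add_eq_one {n R : Type*} [Fintype n] [DecidableEq n] [CommRing R]
    {C E M : Matrix n n R} (hC : IsUnit C) (h : M + M * E * C = C) :
    M * (C⁻¹ + E) = 1 := by
  have hdet := (Matrix.isUnit_iff_isUnit_det C).mp hC
  calc M * (C⁻¹ + E) = (M + M * E * C) * C⁻¹ := by
        rw [mul_add, add_mul, Matrix.mul_nonsing_inv_cancel_right _ _ hdet]
    _ = 1 := by rw [h, Matrix.mul_nonsing_inv _ hdet]

/-- the effective stiffness matrix of a cracked VTI background:
`(S₀ + ΔS)⁻¹` has the explicit closed form in terms of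
`δ_N, δ_T1, δ_T2`, where `S₀` is the inverse of the VTI stiffness matrix and
`ΔS` carries the crack compliances `Z_N, Z_T`. -/
theorem effective_stiffness_of_cracked_vti (c11 c33 c13 c44 c66 Z_N Z_T : ℝ)
    (h1 : c11 - |c11 - 2 * c66| > 0)
    (h2 : c33 * (c11 + (c11 - 2 * c66)) > 2 * c13 ^ 2)
    (h3 : c44 > 0) (hZN : 0 ≤ Z_N) (hZT : 0 ≤ Z_T) :
    let c12 : ℝ := c11 - 2 * c66
    let S₀ : Matrix (Fin 6) (Fin 6) ℝ := (vtiMatrix c11 c33 c13 c44 c66)⁻¹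
    let ΔS : Matrix (Fin 6) (Fin 6) ℝ :=
      !![Z_N, 0, 0, 0, 0, 0;
         0, 0, 0, 0, 0, 0;
         0, 0, 0, 0, 0, 0;
         0, 0, 0, 0, 0, 0;
         0, 0, 0, 0, Z_T, 0;
         0, 0, 0, 0, 0, Z_T]
    let δN : ℝ := Z_N * c11 / (1 + Z_N * c11)
    let δT1 : ℝ := Z_T * c44 / (1 + Z_T * c44)
    let δT2 : ℝ := Z_T * c66 / (1 + Z_T * c66)
    IsUnit (S₀ + ΔS) ∧
    (S₀ + ΔS)⁻¹ =
      !![c11 * (1 - δN), c12 * (1 - δN), c13 * (1 - δN), 0, 0, 0;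
         c12 * (1 - δN), c11 * (1 - δN * c12 ^ 2 / c11 ^ 2),
           c13 * (1 - δN * c12 / c11), 0, 0, 0;
         c13 * (1 - δN), c13 * (1 - δN * c12 / c11),
           c33 * (1 - δN * c13 ^ 2 / (c11 * c33)), 0, 0, 0;
         0, 0, 0, c44, 0, 0;
         0, 0, 0, 0, c44 * (1 - δT1), 0;
         0, 0, 0, 0, 0, c66 * (1 - δT2)] := by
  intro c12 S₀ ΔS δN δT1 δT2
  have hc12 := abs_lt.mp (sub_pos.mp h1)
  have h66 : 0 < c66 := by linarith [hc12.2]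
  have h11 : 0 < c11 := (abs_nonneg _).trans_lt (sub_pos.mp h1)
  have h33 : 0 < c33 :=
    pos_of_mul_pos_left (lt_of_le_of_lt (by positivity) h2) (by linarith [hc12.1])
  have hN : 1 + Z_N * c11 ≠ 0 := by positivity
  have hT1 : 1 + Z_T * c44 ≠ 0 := by positivity
  have hT2 : 1 + Z_T * c66 ≠ 0 := by positivity
  have hC : IsUnit (vtiMatrix c11 c33 c13 c44 c66) :=
    isUnit_vtiMatrix h3.ne' h66.ne' (sub_pos.mpr h2).ne'
  refine (fun h => ⟨IsUnit.of_mul_eq_one_right _ h, Matrix.inv_eq_left_inv h⟩)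
    (Matrix.mul_inv_add_eq_one hC ?_)
  ext i j
  fin_cases i <;> fin_cases j <;>
    simp [vtiMatrix, ΔS, c12, δN, δT1, δT2] <;>
    field_simp <;> ring
end

section
/- Let c11, c33, c13, c44, c66 satisfy the VTI stability conditions. If c11 ≥ c33 and c11 ≥ 2·c44, then c11·c1·c3·(c2 + c3 − c4) ≥ 2·(c1² − c13²). -/
/-- The stability conditions force `0 < c33` and `|c13| < c₁`. -/
theorem abs_lt_cc1_of_stability {c11 c33 c13 c66 : ℝ}
    (h1 : c11 - |c11 - 2 * c66| > 0)
    (h2 : c33 * (c11 + (c11 - 2 * c66)) > 2 * c13 ^ 2) :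
    0 < c33 ∧ |c13| < cc1 c11 c33 := by
  obtain ⟨hl, hr⟩ := abs_lt.mp (sub_pos.mp h1)
  have h33 : 0 < c33 :=
    pos_of_mul_pos_left (lt_of_le_of_lt (by positivity) h2) (by linarith)
  refine ⟨h33, ?_⟩
  have h66 : 0 < c33 * c66 := mul_pos h33 (by linarith)
  exact Real.lt_sqrt_of_sq_lt (by rw [sq_abs]; nlinarith)

/-- `c₃·(c₃ − c₄) = (c₁² − c13²)/(c33·c44)`. -/
theorem cc3_mul_cc3_sub_cc4 {c11 c33 c13 c44 : ℝ} (h33 : 0 < c33) (h44 : 0 < c44)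
    (h : |c13| < cc1 c11 c33) :
    cc3 c11 c33 c13 c44 * (cc3 c11 c33 c13 c44 - cc4 c11 c33 c13 c44) =
      (cc1 c11 c33 ^ 2 - c13 ^ 2) / (c33 * c44) := by
  obtain ⟨hl, hr⟩ := abs_lt.mp h
  have hm : 0 < cc1 c11 c33 - c13 := by linarith
  have hS : 0 < cc1 c11 c33 + c13 + 2 * c44 := by linarith
  have hsq : cc3 c11 c33 c13 c44 ^ 2 =
      (cc1 c11 c33 - c13) * (cc1 c11 c33 + c13 + 2 * c44) / (c33 * c44) :=
    Real.sq_sqrt (by positivity)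
  calc cc3 c11 c33 c13 c44 * (cc3 c11 c33 c13 c44 - cc4 c11 c33 c13 c44)
      = cc3 c11 c33 c13 c44 ^ 2 * (cc1 c11 c33 + c13) /
          (cc1 c11 c33 + c13 + 2 * c44) := by
        rw [cc4]; field_simp; ring
    _ = (cc1 c11 c33 ^ 2 - c13 ^ 2) / (c33 * c44) := by
        rw [hsq]; field_simp; ring

/-- under the VTI stability conditions, if `c11 ≥ c33` and
`c11 ≥ 2·c44` then `c11·c₁·c₃·(c₂ + c₃ − c₄) ≥ 2·(c₁² − c13²)`. -/
theorem chi_monotonicity_sufficient_condition (c11 c33 c13 c44 c66 : ℝ)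
    (h1 : c11 - |c11 - 2 * c66| > 0)
    (h2 : c33 * (c11 + (c11 - 2 * c66)) > 2 * c13 ^ 2)
    (h3 : c44 > 0)
    (h4 : c11 ≥ c33) (h5 : c11 ≥ 2 * c44) :
    c11 * cc1 c11 c33 * cc3 c11 c33 c13 c44 *
        (cc2 c44 c66 + cc3 c11 c33 c13 c44 - cc4 c11 c33 c13 c44)
      ≥ 2 * ((cc1 c11 c33) ^ 2 - c13 ^ 2) := by
  obtain ⟨h33, h⟩ := abs_lt_cc1_of_stability h1 h2
  have hc1 : 0 < cc1 c11 c33 := (abs_nonneg _).trans_lt h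
  have h11 : 0 < c11 := h33.trans_le h4
  have hdiff : 0 ≤ cc1 c11 c33 ^ 2 - c13 ^ 2 :=
    sub_nonneg.mpr (sq_le_sq.mpr (by rw [abs_of_pos hc1]; exact h.le))
  have hc33 : c33 ≤ cc1 c11 c33 := Real.le_sqrt_of_sq_le (by nlinarith)
  have hc2 : 0 ≤ cc2 c44 c66 := Real.sqrt_nonneg _
  have hc3 : 0 ≤ cc3 c11 c33 c13 c44 := Real.sqrt_nonneg _
  have hfactor : 2 ≤ c11 * cc1 c11 c33 / (c33 * c44) := by
    rw [le_div_iff₀ (by positivity)]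
    calc 2 * (c33 * c44) = 2 * c44 * c33 := by ring
      _ ≤ c11 * cc1 c11 c33 := by gcongr
  calc 2 * (cc1 c11 c33 ^ 2 - c13 ^ 2)
      ≤ c11 * cc1 c11 c33 / (c33 * c44) * (cc1 c11 c33 ^ 2 - c13 ^ 2) := by gcongr
    _ = c11 * cc1 c11 c33 *
          (cc3 c11 c33 c13 c44 * (cc3 c11 c33 c13 c44 - cc4 c11 c33 c13 c44)) := by
        rw [cc3_mul_cc3_sub_cc4 h33 h3 h]; ring
    _ ≤ c11 * cc1 c11 c33 *
          (cc3 c11 c33 c13 c44 * (cc3 c11 c33 c13 c44 - cc4 c11 c33 c13 c44)) +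
        c11 * cc1 c11 c33 * cc3 c11 c33 c13 c44 * cc2 c44 c66 :=
        le_add_of_nonneg_right (by positivity)
    _ = c11 * cc1 c11 c33 * cc3 c11 c33 c13 c44 *
          (cc2 c44 c66 + cc3 c11 c33 c13 c44 - cc4 c11 c33 c13 c44) := by ring
end

section
/- Let p > 4/3 and θ ∈ (0, π/2), and define ΔR(e) = [4·e/((p−1)·(16·e+3))]·sin²θ·[a(e) − (p−1)·tan²θ], where a(e) = (−p²·(16·e+18) + p·(64·e+60) − 36)/(p·(16·e+9) − 6). If ΔR(e) > 0 for every e > 0, then ΔR is strictly increasing on (0, ∞). -/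
open Real

/-- `a(e)` in the isotropic-background factorization of `ΔR_pp^ℓ`. -/
noncomputable def aIso (p e : ℝ) : ℝ :=
  (-p ^ 2 * (16 * e + 18) + p * (64 * e + 60) - 36) / (p * (16 * e + 9) - 6)

/-- `ΔR_pp^ℓ(e) = k_p(e)·sin²θ·(a(e) − (p−1)·tan²θ)` for an isotropic
background. -/
noncomputable def ΔR (p θ e : ℝ) : ℝ :=
  (4 * e / ((p - 1) * (16 * e + 3))) * sin θ ^ 2 *
    (aIso p e - (p - 1) * tan θ ^ 2)

lemma nonneg_coeffs_of_forall_affine_pos {A B : ℝ} (h : ∀ x : ℝ, 0 < x → 0 < A * x + B) :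
    0 ≤ A ∧ 0 ≤ B := by
  constructor
  · by_contra! hA
    have h' := h ((|B| + 1) / (-A)) (div_pos (by positivity) (by linarith))
    have e : A * ((|B| + 1) / (-A)) = -(|B| + 1) := by
      field_simp [hA.ne]
    rw [e] at h'
    linarith [le_abs_self B]
  · by_contra! hB
    have hA : 0 < |A| + 1 := by positivity
    have hx : 0 < -B / (|A| + 1) := div_pos (by linarith) hA
    have h' := h _ hx
    have e : (|A| + 1) * (-B / (|A| + 1)) = -B := by field_simp
    nlinarith [le_abs_self A]

/-- With `x = 16 e` and `T = (p - 1) tan² θ`, the difference `ΔR` is a multiple of a ratio of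
quadratic polynomials in `x`. -/
lemma ΔR_eq_ratio {p e : ℝ} (θ : ℝ) (hp : 4 / 3 < p) (he : 0 < e) :
    ΔR p θ e = sin θ ^ 2 / (4 * (p - 1)) *
      (16 * e * (p * (4 - p - (p - 1) * tan θ ^ 2) * (16 * e) +
        (-18 * p ^ 2 + 60 * p - 36 - (p - 1) * tan θ ^ 2 * (9 * p - 6))) /
        ((16 * e + 3) * (p * (16 * e) + (9 * p - 6)))) := by
  have h1 : p - 1 ≠ 0 := by linarith
  have h2 : 16 * e + 3 ≠ 0 := by positivity
  have h3 : p * (16 * e + 9) - 6 ≠ 0 := by nlinarith [mul_pos (by linarith : 0 < p) he]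
  have h4 : p * (16 * e) + (9 * p - 6) = p * (16 * e + 9) - 6 := by ring
  rw [h4]
  unfold ΔR aIso
  generalize tan θ = t
  generalize sin θ = s
  generalize hd : p * (16 * e + 9) - 6 = d at h3 ⊢
  field_simp
  rw [← hd]
  ring

/-- The ratio of quadratics is strictly increasing when its numerator has nonnegative coefficients. -/
lemma ratio_lt_ratio {p T x y : ℝ} (hp : 4 / 3 < p)
    (hA : 0 ≤ 4 - p - T) (hB : 0 ≤ -18 * p ^ 2 + 60 * p - 36 - T * (9 * p - 6))
    (hx : 0 < x) (hxy : x < y) :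
    x * (p * (4 - p - T) * x + (-18 * p ^ 2 + 60 * p - 36 - T * (9 * p - 6))) /
        ((x + 3) * (p * x + (9 * p - 6))) <
      y * (p * (4 - p - T) * y + (-18 * p ^ 2 + 60 * p - 36 - T * (9 * p - 6))) /
        ((y + 3) * (p * y + (9 * p - 6))) := by
  have hp0 : 0 < p := by linarith
  have hy : 0 < y := hx.trans hxy
  have hD : 0 < 9 * p - 6 := by linarith
  rw [div_lt_div_iff₀ (by positivity) (by positivity), ← sub_pos]
  have hQ : 0 < 6 * p ^ 2 - 6 * p + 12 - 3 * p * T := by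
    nlinarith [mul_nonneg hp0.le hA, sq_nonneg (p - 1)]
  have key : 0 < (y - x) * (p * (6 * p ^ 2 - 6 * p + 12 - 3 * p * T) * (x * y) +
      3 * (p * (4 - p - T)) * (9 * p - 6) * (x + y) +
      3 * (-18 * p ^ 2 + 60 * p - 36 - T * (9 * p - 6)) * (9 * p - 6)) := by
    have := sub_pos.2 hxy
    positivity
  linarith

/-- if `p > 4/3`, `θ ∈ (0, π/2)`, and `ΔR(e) > 0` for every
`e > 0`, then `ΔR` is strictly increasing on `(0, ∞)`. -/
theorem deltaR_strictMono_of_pos (p θ : ℝ) (hp : p > 4 / 3)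
    (hθ1 : 0 < θ) (hθ2 : θ < π / 2)
    (hpos : ∀ e : ℝ, 0 < e → 0 < ΔR p θ e) :
    StrictMonoOn (ΔR p θ) (Set.Ioi 0) := by
  have hp0 : 0 < p := by linarith
  have hK : 0 < sin θ ^ 2 / (4 * (p - 1)) :=
    div_pos (pow_pos (sin_pos_of_pos_of_lt_pi hθ1 (by linarith [pi_pos])) 2) (by linarith)
  have hlin : ∀ x : ℝ, 0 < x → 0 < p * (4 - p - (p - 1) * tan θ ^ 2) * x +
      (-18 * p ^ 2 + 60 * p - 36 - (p - 1) * tan θ ^ 2 * (9 * p - 6)) := by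
    intro x hx
    have h := hpos (x / 16) (by positivity)
    have hD : 0 < 9 * p - 6 := by linarith
    rw [ΔR_eq_ratio θ hp (by positivity), mul_div_cancel₀ x (by norm_num : (16 : ℝ) ≠ 0),
      mul_pos_iff_of_pos_left hK, div_pos_iff_of_pos_right (by positivity),
      mul_pos_iff_of_pos_left hx] at h
    exact h
  obtain ⟨hA, hB⟩ := nonneg_coeffs_of_forall_affine_pos hlin
  intro x hx y hy hxy
  rw [ΔR_eq_ratio θ hp hx, ΔR_eq_ratio θ hp hy]
  exact mul_lt_mul_of_pos_left
    (ratio_lt_ratio hp (nonneg_of_mul_nonneg_right hA hp0) hB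
      (mul_pos (by norm_num) hx) (by linarith)) hK
end

section
/- Let Z_N > 0, Z_T > 0, c66 > 0, p11 > 1, k_p > 0, θ ∈ (0, π/2), ψ ∈ (0, π/2), and let a, b be real numbers. Define β = b + [(Z_N − Z_T)·(1 − sin²ψ) − Z_N·Z_T·c66·(1 − sin²ψ)·(p11 − 1)]/(Z_N·(1 + c66·Z_T)). Assume Z_N ≤ Z_T. If k_p·sin²θ·sin²ψ·(a − β·tan²θ) < 0, then k_p·sin²θ·sin²ψ·(a − β·tan²θ) > k_p·sin²θ·(a − b·tan²θ). In other words, under Z_N ≤ Z_T and p11 > 1, the irregularity condition "ΔR_ppψ^ℓ < 0 and ΔR_ppψ^ℓ < ΔR_pp^ℓ" cannot hold. -/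
open Real

/-- for a VTI background with `Z_N ≤ Z_T` and `p11 > 1`, the
irregularity alternative `ΔR_ppψ^ℓ < 0 ∧ ΔR_ppψ^ℓ < ΔR_pp^ℓ` cannot hold:
if `ΔR_ppψ^ℓ = k_p·sin²θ·sin²ψ·(a − β·tan²θ) < 0`, then
`ΔR_ppψ^ℓ > ΔR_pp^ℓ = k_p·sin²θ·(a − b·tan²θ)`. -/
theorem no_negative_irregularity_vti (Z_N Z_T c66 p11 k_p θ ψ a b : ℝ)
    (hZN : 0 < Z_N) (hZT : 0 < Z_T) (hc66 : 0 < c66) (hp11 : 1 < p11)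
    (hkp : 0 < k_p)
    (hθ1 : 0 < θ) (hθ2 : θ < π / 2)
    (hψ1 : 0 < ψ) (hψ2 : ψ < π / 2)
    (hZ : Z_N ≤ Z_T) :
    let β : ℝ := b +
      ((Z_N - Z_T) * (1 - sin ψ ^ 2)
          - Z_N * Z_T * c66 * (1 - sin ψ ^ 2) * (p11 - 1)) /
        (Z_N * (1 + c66 * Z_T))
    k_p * sin θ ^ 2 * sin ψ ^ 2 * (a - β * tan θ ^ 2) < 0 →
    k_p * sin θ ^ 2 * sin ψ ^ 2 * (a - β * tan θ ^ 2)
      > k_p * sin θ ^ 2 * (a - b * tan θ ^ 2) := by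
  intro β hneg
  have hs : 0 < sin θ ^ 2 := pow_pos (sin_pos_of_pos_of_lt_pi hθ1 (by linarith [pi_pos])) 2
  have hψ : 0 < sin ψ ^ 2 := pow_pos (sin_pos_of_pos_of_lt_pi hψ1 (by linarith [pi_pos])) 2
  have ht : 0 < tan θ ^ 2 := pow_pos (tan_pos_of_pos_of_lt_pi_div_two hθ1 hθ2) 2
  have hc : 0 < 1 - sin ψ ^ 2 := by
    rw [← cos_sq']
    exact pow_pos (cos_pos_of_mem_Ioo ⟨by linarith [pi_pos], hψ2⟩) 2
  have hβ : β < b := by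
    have hnum : (Z_N - Z_T) * (1 - sin ψ ^ 2)
        - Z_N * Z_T * c66 * (1 - sin ψ ^ 2) * (p11 - 1) < 0 := by
      have h_crack : (Z_N - Z_T) * (1 - sin ψ ^ 2) ≤ 0 :=
        mul_nonpos_of_nonpos_of_nonneg (sub_nonpos.mpr hZ) hc.le
      have h_background : 0 < Z_N * Z_T * c66 * (1 - sin ψ ^ 2) * (p11 - 1) :=
        mul_pos (by positivity) (sub_pos.mpr hp11)
      linarith
    have hdiv := div_neg_of_neg_of_pos hnum
      (show 0 < Z_N * (1 + c66 * Z_T) by positivity)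
    simp only [β]
    linarith
  have hX : a - β * tan θ ^ 2 < 0 := neg_of_mul_neg_right hneg (by positivity)
  have hlt : a - b * tan θ ^ 2 < sin ψ ^ 2 * (a - β * tan θ ^ 2) := by
    have h_tan := mul_lt_mul_of_pos_right hβ ht
    have h_sin := mul_neg_of_pos_of_neg hc hX
    linarith
  rw [gt_iff_lt, mul_assoc (k_p * sin θ ^ 2)]
  exact mul_lt_mul_of_pos_left hlt (mul_pos hkp hs)
end

section
/- Let p > 4/3, e ≥ 0, ψ ∈ (0, π/2), and define b = p − 1 and β = [12·p·((3/4)·p − 1) + (2 − p)·(6 − 3·sin²ψ) + 16·p·e·(p − 1)·sin²ψ]/(16·p·e + 9·p − 6). Then (i) β − b = (1 − sin²ψ)·(3·(2 − p) − 16·p·e·(p − 1))/(16·p·e + 9·p − 6); (ii) if p ≥ 2 and e > 0 then β < b; (iii) consequently, if p ≥ 2, e > 0, θ ∈ (0, π/2), k > 0, a ∈ ℝ, and k·sin²θ·sin²ψ·(a − β·tan²θ) < 0, then k·sin²θ·sin²ψ·(a − β·tan²θ) > k·sin²θ·(a − b·tan²θ). -/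
open Real

/-- for the isotropic-background azimuthal factors with
`p > 4/3`, `e ≥ 0`, `ψ ∈ (0, π/2)`:
(i) `β − b = (1 − sin²ψ)·(3·(2 − p) − 16·p·e·(p − 1))/(16·p·e + 9·p − 6)`;
(ii) if `p ≥ 2` and `e > 0` then `β < b`;
(iii) consequently, if moreover `θ ∈ (0, π/2)`, `k > 0` and
`k·sin²θ·sin²ψ·(a − β·tan²θ) < 0`, then
`k·sin²θ·sin²ψ·(a − β·tan²θ) > k·sin²θ·(a − b·tan²θ)`. -/
theorem no_negative_irregularity_iso (p e ψ : ℝ)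
    (hp : p > 4 / 3) (he : 0 ≤ e) (hψ1 : 0 < ψ) (hψ2 : ψ < π / 2) :
    let b : ℝ := p - 1
    let β : ℝ :=
      (12 * p * ((3 / 4) * p - 1) + (2 - p) * (6 - 3 * sin ψ ^ 2)
          + 16 * p * e * (p - 1) * sin ψ ^ 2) /
        (16 * p * e + 9 * p - 6)
    (β - b = (1 - sin ψ ^ 2) * (3 * (2 - p) - 16 * p * e * (p - 1)) /
        (16 * p * e + 9 * p - 6)) ∧
    (p ≥ 2 → 0 < e → β < b) ∧
    (p ≥ 2 → 0 < e → ∀ θ : ℝ, 0 < θ → θ < π / 2 → ∀ k : ℝ, 0 < k → ∀ a : ℝ,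
      k * sin θ ^ 2 * sin ψ ^ 2 * (a - β * tan θ ^ 2) < 0 →
      k * sin θ ^ 2 * sin ψ ^ 2 * (a - β * tan θ ^ 2)
        > k * sin θ ^ 2 * (a - b * tan θ ^ 2)) := by
  intro b β
  have hsin : 0 < sin ψ := sin_pos_of_pos_of_lt_pi hψ1 (by linarith [pi_pos])
  have hcos : 0 < cos ψ := cos_pos_of_mem_Ioo ⟨by linarith [pi_pos], hψ2⟩
  have hs0 : 0 < sin ψ ^ 2 := by positivity
  have hs1 : 0 < 1 - sin ψ ^ 2 := by
    rw [← cos_sq']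
    positivity
  have hpe : 0 ≤ p * e := mul_nonneg (by linarith) he
  have hD : 0 < 16 * p * e + 9 * p - 6 := by linarith
  have hdiff : β - b = (1 - sin ψ ^ 2) * (3 * (2 - p) - 16 * p * e * (p - 1)) /
      (16 * p * e + 9 * p - 6) := by
    simp only [β, b]
    rw [div_sub' hD.ne']
    congr 1
    ring
  have hlt : p ≥ 2 → 0 < e → β < b := by
    intro hp2 he0
    have hprod : 0 < p * e * (p - 1) :=
      mul_pos (mul_pos (by linarith) he0) (by linarith)
    rw [← sub_neg, hdiff]
    exact div_neg_of_neg_of_pos (mul_neg_of_pos_of_neg hs1 (by linarith)) hD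
  refine ⟨hdiff, hlt, ?_⟩
  intro hp2 he0 θ hθ1 hθ2 k hk a hneg
  have hsinθ : 0 < sin θ := sin_pos_of_pos_of_lt_pi hθ1 (by linarith [pi_pos])
  have htan : 0 < tan θ := tan_pos_of_pos_of_lt_pi_div_two hθ1 hθ2
  have hK : 0 < k * sin θ ^ 2 := by positivity
  have hX : a - β * tan θ ^ 2 < 0 := neg_of_mul_neg_right hneg (by positivity)
  have hbt : β * tan θ ^ 2 < b * tan θ ^ 2 :=
    mul_lt_mul_of_pos_right (hlt hp2 he0) (by positivity)
  have hscale : a - β * tan θ ^ 2 < sin ψ ^ 2 * (a - β * tan θ ^ 2) := by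
    linarith [mul_neg_of_pos_of_neg hs1 hX]
  rw [gt_iff_lt, mul_assoc (k * sin θ ^ 2)]
  exact mul_lt_mul_of_pos_left (by linarith) hK
end

section
/- Let Z_N > 0, Z_T > 0, c66 > 0, p11 ∈ ℝ, k_p > 0, θ ∈ (0, π/2), and a, b ∈ ℝ, and for ψ ∈ (0, π/2) define β(ψ) = b + [(Z_N − Z_T)·(1 − sin²ψ) − Z_N·Z_T·c66·(1 − sin²ψ)·(p11 − 1)]/(Z_N·(1 + c66·Z_T)). If k_p·sin²θ·(a − b·tan²θ) = 0 (the reversing point) and k_p·sin²θ·sin²ψ·(a − β(ψ)·tan²θ) = 0 for every ψ ∈ (0, π/2) (the polar graph is a regular circle), then Z_N − Z_T = Z_N·Z_T·c66·(p11 − 1); in particular, β(ψ) = b for every ψ and a = b·tan²θ. -/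
open Real

/-- at a reversing point (`ΔR_pp^ℓ = 0`) whose polar graph is a
regular circle (`ΔR_ppψ^ℓ = 0` for every azimuth `ψ ∈ (0, π/2)`), the crack
compliances must satisfy `Z_N − Z_T = Z_N·Z_T·c66·(p11 − 1)`; in particular
`β(ψ) = b` for every `ψ ∈ (0, π/2)` and `a = b·tan²θ`. -/
theorem reversing_point_regular_circle (Z_N Z_T c66 p11 k_p θ a b : ℝ)
    (hZN : 0 < Z_N) (hZT : 0 < Z_T) (hc66 : 0 < c66) (hkp : 0 < k_p)
    (hθ1 : 0 < θ) (hθ2 : θ < π / 2)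
    (hrev : k_p * sin θ ^ 2 * (a - b * tan θ ^ 2) = 0)
    (hcirc : ∀ ψ : ℝ, 0 < ψ → ψ < π / 2 →
      k_p * sin θ ^ 2 * sin ψ ^ 2 *
        (a - (b + ((Z_N - Z_T) * (1 - sin ψ ^ 2)
              - Z_N * Z_T * c66 * (1 - sin ψ ^ 2) * (p11 - 1)) /
            (Z_N * (1 + c66 * Z_T))) * tan θ ^ 2) = 0) :
    Z_N - Z_T = Z_N * Z_T * c66 * (p11 - 1) ∧
    (∀ ψ : ℝ, 0 < ψ → ψ < π / 2 →
      b + ((Z_N - Z_T) * (1 - sin ψ ^ 2)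
            - Z_N * Z_T * c66 * (1 - sin ψ ^ 2) * (p11 - 1)) /
          (Z_N * (1 + c66 * Z_T)) = b) ∧
    a = b * tan θ ^ 2 := by
  have hs : sin θ ≠ 0 := (sin_pos_of_pos_of_lt_pi hθ1 (by linarith)).ne'
  have ht : tan θ ^ 2 ≠ 0 := pow_ne_zero 2 (tan_pos_of_pos_of_lt_pi_div_two hθ1 hθ2).ne'
  have hk : k_p * sin θ ^ 2 ≠ 0 := mul_ne_zero hkp.ne' (pow_ne_zero 2 hs)
  have hD : Z_N * (1 + c66 * Z_T) ≠ 0 := by positivity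
  have ha : a - b * tan θ ^ 2 = 0 := (mul_eq_zero.mp hrev).resolve_left hk
  have hβ : ∀ ψ : ℝ, 0 < ψ → ψ < π / 2 →
      ((Z_N - Z_T) * (1 - sin ψ ^ 2)
        - Z_N * Z_T * c66 * (1 - sin ψ ^ 2) * (p11 - 1)) /
          (Z_N * (1 + c66 * Z_T)) = 0 := by
    intro ψ h1 h2
    have hsψ : sin ψ ≠ 0 := (sin_pos_of_pos_of_lt_pi h1 (by linarith)).ne'
    have h := (mul_eq_zero.mp (hcirc ψ h1 h2)).resolve_left
      (mul_ne_zero hk (pow_ne_zero 2 hsψ))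
    refine (mul_eq_zero.mp ?_).resolve_right ht
    linear_combination ha - h
  refine ⟨?_, fun ψ h1 h2 => by rw [hβ ψ h1 h2, add_zero], sub_eq_zero.mp ha⟩
  have h1 : 0 < π / 4 := by positivity
  have h2 : π / 4 < π / 2 := by linarith [pi_pos]
  have hnum := (div_eq_zero_iff.mp (hβ (π / 4) h1 h2)).resolve_right hD
  have hcos : 1 - sin (π / 4) ^ 2 ≠ 0 := by
    rw [← cos_sq']
    exact pow_ne_zero 2 (cos_pos_of_mem_Ioo ⟨by linarith, h2⟩).ne'
  refine sub_eq_zero.mp ((mul_eq_zero.mp ?_).resolve_right hcos)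
  linear_combination hnum
end
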